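/- Let m ≥ 1, let p, q : Fin m → ℝ be probability distributions (nonnegative, summing to 1) such that q(x) = 0 implies p(x) = 0 for every x, and for each x ∈ Fin m let ρ_x and σ_x be density matrices on a finite index type d such that, whenever p(x) > 0, the support of ρ_x is contained in the support of σ_x. Then D(Σ_x p(x)·ρ_x ‖ Σ_x q(x)·σ_x) ≤ Σ_x p(x)·log(p(x)/q(x)) + Σ_x p(x)·D(ρ_x ‖ σ_x), where summands with p(x) = 0 are taken to be 0. -/

import Mathlib

open scoped Kronecker BigOperators
open Matrix
open scoped ComplexOrder Classical

noncomputable section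

/-- A density matrix: positive semidefinite with unit trace. -/
def IsDensityMatrix {d : Type*} [Fintype d] (ρ : Matrix d d ℂ) : Prop :=
  ρ.PosSemidef ∧ ρ.trace = 1

/-- Loewner order on Hermitian matrices: `A ≤ B` iff `B - A` is positive semidefinite. -/
def LoewnerLE {d : Type*} [Fintype d] (A B : Matrix d d ℂ) : Prop := (B - A).PosSemidef

/-- Partial trace over the second tensor factor. -/
def ptrace2 {d₁ d₂ : Type*} [Fintype d₂] (M : Matrix (d₁ × d₂) (d₁ × d₂) ℂ) :
    Matrix d₁ d₁ ℂ :=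
  fun i i' => ∑ k, M (i, k) (i', k)

/-- Partial trace over the first tensor factor. -/
def ptrace1 {d₁ d₂ : Type*} [Fintype d₁] (M : Matrix (d₁ × d₂) (d₁ × d₂) ℂ) :
    Matrix d₂ d₂ ℂ :=
  fun j j' => ∑ k, M (k, j) (k, j')

/-- Functional calculus for Hermitian matrices: apply `f` to the eigenvalues. -/
def hermCFC {d : Type*} [Fintype d] [DecidableEq d] (f : ℝ → ℝ) (A : Matrix d d ℂ) :
    Matrix d d ℂ :=
  if hA : A.IsHermitian then
    (hA.eigenvectorUnitary : Matrix d d ℂ) *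
      Matrix.diagonal (fun i => (f (hA.eigenvalues i) : ℂ)) *
      (star (hA.eigenvectorUnitary : Matrix d d ℂ))
  else 0

/-- Matrix logarithm, base 2, applied to nonzero eigenvalues. -/
def matLog2 {d : Type*} [Fintype d] [DecidableEq d] (A : Matrix d d ℂ) : Matrix d d ℂ :=
  hermCFC (Real.logb 2) A

/-- Positive semidefinite square root (via functional calculus). -/
def matSqrt {d : Type*} [Fintype d] [DecidableEq d] (A : Matrix d d ℂ) : Matrix d d ℂ :=
  hermCFC Real.sqrt A

/-- Support containment: the kernel of `σ` is contained in the kernel of `ρ`. -/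
def SupportLE {d : Type*} [Fintype d] (ρ σ : Matrix d d ℂ) : Prop :=
  ∀ v : d → ℂ, σ.mulVec v = 0 → ρ.mulVec v = 0

/-- Relative entropy, base 2, as a real number (meaningful when supports are nested). -/
def relentR {d : Type*} [Fintype d] [DecidableEq d] (ρ σ : Matrix d d ℂ) : ℝ :=
  ((ρ * matLog2 ρ).trace - (ρ * matLog2 σ).trace).re

/-- Relative entropy `D(ρ‖σ)`, base 2, valued in the extended reals: `+∞` unless
the support of `ρ` is contained in the support of `σ`. -/
def relent {d : Type*} [Fintype d] [DecidableEq d] (ρ σ : Matrix d d ℂ) : EReal :=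
  if SupportLE ρ σ then ((relentR ρ σ : ℝ) : EReal) else ⊤

/-- Mutual information `I(A:B)_ρ = D(ρ_AB ‖ ρ_A ⊗ ρ_B)`. -/
def mutInfo {d₁ d₂ : Type*} [Fintype d₁] [Fintype d₂] [DecidableEq d₁] [DecidableEq d₂]
    (ρ : Matrix (d₁ × d₂) (d₁ × d₂) ℂ) : EReal :=
  relent ρ (ptrace2 ρ ⊗ₖ ptrace1 ρ)

/-- Fidelity `F(ρ,σ) = Tr √(√σ ρ √σ)`. -/
def fidelity {d : Type*} [Fintype d] [DecidableEq d] (ρ σ : Matrix d d ℂ) : ℝ :=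
  ((matSqrt (matSqrt σ * ρ * matSqrt σ)).trace).re

/-- Purified distance `P(ρ,σ) = √(1 - F(ρ,σ)²)`. -/
def pdist {d : Type*} [Fintype d] [DecidableEq d] (ρ σ : Matrix d d ℂ) : ℝ :=
  Real.sqrt (1 - (fidelity ρ σ) ^ 2)

/-- Max-relative entropy `Dmax(ρ‖σ) = inf {λ : ρ ≤ 2^λ σ}`, valued in the extended reals. -/
def dmax {d : Type*} [Fintype d] (ρ σ : Matrix d d ℂ) : EReal :=
  sInf {x : EReal | ∃ l : ℝ, x = (l : EReal) ∧ LoewnerLE ρ (((2 : ℝ) ^ l) • σ)}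

/-- Max-information `Imax(A:B)_ρ`. -/
def imax {d₁ d₂ : Type*} [Fintype d₁] [Fintype d₂]
    (ρ : Matrix (d₁ × d₂) (d₁ × d₂) ℂ) : EReal :=
  ⨅ σ : {σ : Matrix d₂ d₂ ℂ // IsDensityMatrix σ}, dmax ρ (ptrace2 ρ ⊗ₖ σ.1)

/-- Smooth max-information `Imax^ε(A:B)_ρ`. -/
def imaxEps {d₁ d₂ : Type*} [Fintype d₁] [Fintype d₂] [DecidableEq d₁] [DecidableEq d₂]
    (ε : ℝ) (ρ : Matrix (d₁ × d₂) (d₁ × d₂) ℂ) : EReal :=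
  ⨅ ρ' : {ρ' : Matrix (d₁ × d₂) (d₁ × d₂) ℂ // IsDensityMatrix ρ' ∧ pdist ρ ρ' ≤ ε},
    imax ρ'.1

/-- The `j`-th term of the convex split: `ρ` on `P` and the `j`-th copy of `Q`, and
`σ` on every other copy of `Q`. -/
def blockState {P Q : Type*} [Fintype Q] [DecidableEq Q]
    (ρ : Matrix (P × Q) (P × Q) ℂ) (σ : Matrix Q Q ℂ) (n : ℕ) (j : Fin n) :
    Matrix (P × (Fin n → Q)) (P × (Fin n → Q)) ℂ :=
  fun x y => ρ (x.1, x.2 j) (y.1, y.2 j) * ∏ i ∈ Finset.univ.erase j, σ (x.2 i) (y.2 i)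

/-- The convex-split state `τ = (1/n) Σ_j ρ_{PQ_j} ⊗ σ_{Q_1} ⊗ ⋯ ⊗ σ_{Q_n}` (omitting `j`). -/
def convexSplit {P Q : Type*} [Fintype Q] [DecidableEq Q]
    (ρ : Matrix (P × Q) (P × Q) ℂ) (σ : Matrix Q Q ℂ) (n : ℕ) :
    Matrix (P × (Fin n → Q)) (P × (Fin n → Q)) ℂ :=
  ((n : ℂ)⁻¹) • ∑ j : Fin n, blockState ρ σ n j

/-- A finite nonempty index type. -/
structure FinIdx where
  carrier : Type
  [fin : Fintype carrier]
  [deq : DecidableEq carrier]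
  [ne : Nonempty carrier]

attribute [instance] FinIdx.fin FinIdx.deq FinIdx.ne
open Filter Topology

section SpectralSums

variable {d : Type*} [Fintype d] [DecidableEq d]

lemma trace_conjTranspose_mul_diagonal_mul_mul_diagonal (M N : Matrix d d ℂ) (b a : d → ℂ) :
    (Mᴴ * diagonal b * N * diagonal a).trace =
      ∑ j, ∑ i, star (M j i) * N j i * b j * a i := by
  rw [Finset.sum_comm]
  refine Finset.sum_congr rfl fun i _ => ?_
  rw [diag_apply, mul_diagonal, mul_apply, Finset.sum_mul]
  refine Finset.sum_congr rfl fun j _ => ?_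
  rw [mul_diagonal, conjTranspose_apply]
  ring

/-- The matrix `U diag(a) U⋆`. -/
def spectralMatrix (U : Matrix d d ℂ) (a : d → ℝ) : Matrix d d ℂ :=
  U * diagonal (fun i => (a i : ℂ)) * Uᴴ

/-- The transition weights `|⟨v_j, u_i⟩|²` between the columns of `V` and those of `U`. -/
def overlap (U V : Matrix d d ℂ) (j i : d) : ℝ := Complex.normSq ((Vᴴ * U) j i)

omit [DecidableEq d] in
lemma star_mul_self_eq_overlap (U V : Matrix d d ℂ) (j i : d) :
    star ((Vᴴ * U) j i) * (Vᴴ * U) j i = (overlap U V j i : ℂ) :=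
  Complex.normSq_eq_conj_mul_self.symm

lemma trace_spectralMatrix_mul_spectralMatrix (U V : Matrix d d ℂ) (a b : d → ℝ) :
    (spectralMatrix U a * spectralMatrix V b).trace =
      ((∑ j, ∑ i, overlap U V j i * a i * b j : ℝ) : ℂ) := by
  have h : (spectralMatrix U a * spectralMatrix V b).trace =
      ((Vᴴ * U)ᴴ * diagonal (fun i => (b i : ℂ)) * (Vᴴ * U) *
        diagonal (fun i => (a i : ℂ))).trace := by
    rw [trace_mul_comm _ (diagonal fun i => (a i : ℂ))]
    simp only [spectralMatrix, conjTranspose_mul, conjTranspose_conjTranspose, Matrix.mul_assoc]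
    rw [trace_mul_comm U]
    simp only [Matrix.mul_assoc]
  rw [h, trace_conjTranspose_mul_diagonal_mul_mul_diagonal]
  push_cast
  refine Finset.sum_congr rfl fun j _ => Finset.sum_congr rfl fun i _ => ?_
  rw [star_mul_self_eq_overlap]
  ring

lemma trace_spectralMatrix (U : Matrix d d ℂ) {V : Matrix d d ℂ} (hV : V * Vᴴ = 1) (a : d → ℝ) :
    (spectralMatrix U a).trace = ((∑ j, ∑ i, overlap U V j i * a i : ℝ) : ℂ) := by
  simpa [spectralMatrix, hV] using trace_spectralMatrix_mul_spectralMatrix U V a 1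

/-- The functional, linear in `(A, B)`, whose supremum over `X` is
`∑ |⟨v_j, u_i⟩|² a_i² / (b_j + t a_i)`. -/
def resolventFunctional (X A B : Matrix d d ℂ) (t : ℝ) : ℝ :=
  (2 * (Xᴴ * A).trace - (Xᴴ * B * X).trace - t * (X * A * Xᴴ).trace).re

omit [DecidableEq d] in
lemma resolventFunctional_sum {ι : Type*} [Fintype ι] (X : Matrix d d ℂ)
    (A B : ι → Matrix d d ℂ) (t : ℝ) :
    resolventFunctional X (∑ x, A x) (∑ x, B x) t = ∑ x, resolventFunctional X (A x) (B x) t := by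
  simp only [resolventFunctional, Matrix.sum_mul, trace_sum, Finset.mul_sum,
    ← Finset.sum_sub_distrib, Complex.re_sum]

lemma resolventFunctional_spectralMatrix {U V : Matrix d d ℂ} (hU : U * Uᴴ = 1) (hV : V * Vᴴ = 1)
    (a b : d → ℝ) (Y : Matrix d d ℂ) (t : ℝ) :
    resolventFunctional (V * Y * Uᴴ) (spectralMatrix U a) (spectralMatrix V b) t =
      ∑ j, ∑ i, (2 * (star (Y j i) * (Vᴴ * U) j i).re * a i
        - Complex.normSq (Y j i) * (b j + t * a i)) := by
  have hU' : Uᴴ * U = 1 := mul_eq_one_comm.mp hU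
  have hV' : Vᴴ * V = 1 := mul_eq_one_comm.mp hV
  have cU : ∀ M : Matrix d d ℂ, Uᴴ * (U * M) = M := fun M => by
    rw [← Matrix.mul_assoc, hU', Matrix.one_mul]
  have cV : ∀ M : Matrix d d ℂ, Vᴴ * (V * M) = M := fun M => by
    rw [← Matrix.mul_assoc, hV', Matrix.one_mul]
  have h1 : ((V * Y * Uᴴ)ᴴ * spectralMatrix U a).trace =
      (Yᴴ * diagonal (fun _ => (1 : ℂ)) * (Vᴴ * U) * diagonal (fun i => (a i : ℂ))).trace := by
    simp only [spectralMatrix, conjTranspose_mul, conjTranspose_conjTranspose, diagonal_one,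
      Matrix.mul_one, Matrix.mul_assoc]
    rw [trace_mul_comm]
    simp only [Matrix.mul_assoc, hU', Matrix.mul_one]
  have h2 : ((V * Y * Uᴴ)ᴴ * spectralMatrix V b * (V * Y * Uᴴ)).trace =
      (Yᴴ * diagonal (fun i => (b i : ℂ)) * Y * diagonal (fun _ => (1 : ℂ))).trace := by
    simp only [spectralMatrix, conjTranspose_mul, conjTranspose_conjTranspose, diagonal_one,
      Matrix.mul_one, Matrix.mul_assoc, cV]
    rw [trace_mul_comm]
    simp only [Matrix.mul_assoc, hU', Matrix.mul_one]
  have h3 : ((V * Y * Uᴴ) * spectralMatrix U a * (V * Y * Uᴴ)ᴴ).trace =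
      (Yᴴ * diagonal (fun _ => (1 : ℂ)) * Y * diagonal (fun i => (a i : ℂ))).trace := by
    simp only [spectralMatrix, conjTranspose_mul, conjTranspose_conjTranspose, diagonal_one,
      Matrix.mul_one, Matrix.mul_assoc, cU]
    rw [trace_mul_comm]
    simp only [Matrix.mul_assoc, hV', Matrix.mul_one]
    rw [trace_mul_comm, Matrix.mul_assoc, trace_mul_comm]
    simp only [Matrix.mul_assoc]
  rw [resolventFunctional, h1, h2, h3]
  simp only [trace_conjTranspose_mul_diagonal_mul_mul_diagonal, Finset.mul_sum,
    ← Finset.sum_sub_distrib, Complex.re_sum]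
  refine Finset.sum_congr rfl fun j _ => Finset.sum_congr rfl fun i _ => ?_
  simp [Complex.normSq_apply]
  ring

lemma two_mul_re_star_mul_sub_le (y w : ℂ) {a c : ℝ} (hc : 0 ≤ c) (hac : c = 0 → a = 0) :
    2 * (star y * w).re * a - Complex.normSq y * c ≤ Complex.normSq w * a * (a / c) := by
  rcases hc.eq_or_lt with rfl | hc
  · simp [hac rfl]
  · have : 0 ≤ ((c * y.re - w.re * a) ^ 2 + (c * y.im - w.im * a) ^ 2) / c := by positivity
    have e : ((c * y.re - w.re * a) ^ 2 + (c * y.im - w.im * a) ^ 2) / c =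
        Complex.normSq w * a * (a / c) -
          (2 * (star y * w).re * a - Complex.normSq y * c) := by
      simp [Complex.normSq_apply]
      field_simp
      ring
    linarith

lemma resolventFunctional_le {U V : Matrix d d ℂ} (hU : U * Uᴴ = 1) (hV : V * Vᴴ = 1)
    {a b : d → ℝ} (ha : ∀ i, 0 ≤ a i) (hb : ∀ i, 0 ≤ b i) (X : Matrix d d ℂ) {t : ℝ}
    (ht : 0 < t) :
    resolventFunctional X (spectralMatrix U a) (spectralMatrix V b) t ≤
      ∑ j, ∑ i, overlap U V j i * a i * (a i / (b j + t * a i)) := by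
  have hX : X = V * (Vᴴ * X * U) * Uᴴ := by
    rw [Matrix.mul_assoc, Matrix.mul_assoc (Vᴴ * X), hU, Matrix.mul_one, ← Matrix.mul_assoc, hV,
      Matrix.one_mul]
  rw [hX, resolventFunctional_spectralMatrix hU hV]
  refine Finset.sum_le_sum fun j _ => Finset.sum_le_sum fun i _ => ?_
  have hta := mul_nonneg ht.le (ha i)
  refine two_mul_re_star_mul_sub_le _ _ (add_nonneg (hb j) hta) fun h => ?_
  have : t * a i = 0 := by linarith [hb j]
  exact (mul_eq_zero.mp this).resolve_left ht.ne'

lemma exists_resolventFunctional_eq {U V : Matrix d d ℂ} (hU : U * Uᴴ = 1) (hV : V * Vᴴ = 1)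
    (a b : d → ℝ) (t : ℝ) :
    ∃ X, resolventFunctional X (spectralMatrix U a) (spectralMatrix V b) t =
      ∑ j, ∑ i, overlap U V j i * a i * (a i / (b j + t * a i)) := by
  refine ⟨V * (of fun j i => (Vᴴ * U) j i * ((a i / (b j + t * a i) : ℝ) : ℂ)) * Uᴴ, ?_⟩
  rw [resolventFunctional_spectralMatrix hU hV]
  refine Finset.sum_congr rfl fun j _ => Finset.sum_congr rfl fun i _ => ?_
  rw [overlap, of_apply]
  generalize (Vᴴ * U) j i = w
  rcases eq_or_ne (b j + t * a i) 0 with h | h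
  · simp [h]
  · generalize hc : b j + t * a i = c at h ⊢
    simp only [star_mul', Complex.star_def, Complex.conj_ofReal, Complex.normSq_apply,
      Complex.mul_re, Complex.mul_im, Complex.conj_re, Complex.conj_im, Complex.ofReal_re,
      Complex.ofReal_im]
    field_simp
    ring

/-- The function of `t` interpolating between `Tr A log B` (at `t = 0`) and, up to the divergent
term `Tr A log t`, `Tr A log A` (at `t = ∞`). -/
def logInterp (U V : Matrix d d ℂ) (a b : d → ℝ) (t : ℝ) : ℝ :=
  ∑ j, ∑ i, overlap U V j i * a i * Real.log (b j + t * a i)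

omit [DecidableEq d] in
lemma hasDerivAt_logInterp {U V : Matrix d d ℂ} {a b : d → ℝ} (ha : ∀ i, 0 ≤ a i)
    (hs : ∀ j i, overlap U V j i * a i ≠ 0 → 0 < b j) {t : ℝ} (ht : 0 ≤ t) :
    HasDerivAt (logInterp U V a b)
      (∑ j, ∑ i, overlap U V j i * a i * (a i / (b j + t * a i))) t := by
  refine HasDerivAt.fun_sum fun j _ => HasDerivAt.fun_sum fun i _ => ?_
  by_cases h : overlap U V j i * a i = 0
  · simpa [h] using hasDerivAt_const t (0 : ℝ)
  · have hpos : b j + t * a i ≠ 0 :=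
      (add_pos_of_pos_of_nonneg (hs j i h) (mul_nonneg ht (ha i))).ne'
    exact ((by simpa using ((hasDerivAt_id t).mul_const (a i)).const_add (b j) :
      HasDerivAt (fun s => b j + s * a i) (a i) t).log hpos).const_mul _

omit [DecidableEq d] in
lemma tendsto_logInterp {U V : Matrix d d ℂ} {a b : d → ℝ} (ha : ∀ i, 0 ≤ a i)
    (hs : ∀ j i, overlap U V j i * a i ≠ 0 → 0 < b j) :
    Tendsto (fun t => logInterp U V a b t - (∑ j, ∑ i, overlap U V j i * a i) * Real.log t)
      atTop (𝓝 (∑ j, ∑ i, overlap U V j i * a i * Real.log (a i))) := by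
  simp only [logInterp, Finset.sum_mul, ← Finset.sum_sub_distrib]
  refine tendsto_finsetSum _ fun j _ => tendsto_finsetSum _ fun i _ => ?_
  by_cases h : overlap U V j i * a i = 0
  · simp [h]
  · have hai : 0 < a i := (ha i).lt_of_ne' (right_ne_zero_of_mul h)
    have hlim : Tendsto (fun t : ℝ => Real.log (b j / t + a i)) atTop (𝓝 (Real.log (a i))) := by
      have : Tendsto (fun t : ℝ => b j / t + a i) atTop (𝓝 (0 + a i)) :=
        (tendsto_const_nhds.div_atTop tendsto_id).add_const _
      rw [zero_add] at this
      exact this.log hai.ne'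
    refine (hlim.const_mul (overlap U V j i * a i)).congr' ?_
    filter_upwards [eventually_gt_atTop (0 : ℝ)] with t ht
    have hbt : 0 < b j + t * a i := add_pos (hs j i h) (mul_pos ht hai)
    rw [← mul_sub, ← Real.log_div hbt.ne' ht.ne', add_div, mul_div_cancel_left₀ _ ht.ne']

lemma sum_overlap_mul_log_sub_le {ι : Type*} [Fintype ι] {U V : ι → Matrix d d ℂ}
    {a b : ι → d → ℝ} (hU : ∀ x, U x * (U x)ᴴ = 1) (hV : ∀ x, V x * (V x)ᴴ = 1)
    (ha : ∀ x i, 0 ≤ a x i) (hb : ∀ x i, 0 ≤ b x i)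
    (hs : ∀ x j i, overlap (U x) (V x) j i * a x i ≠ 0 → 0 < b x j)
    {U₀ V₀ : Matrix d d ℂ} {a₀ b₀ : d → ℝ} (hU₀ : U₀ * U₀ᴴ = 1) (hV₀ : V₀ * V₀ᴴ = 1)
    (ha₀ : ∀ i, 0 ≤ a₀ i)
    (hs₀ : ∀ j i, overlap U₀ V₀ j i * a₀ i ≠ 0 → 0 < b₀ j)
    (hA : spectralMatrix U₀ a₀ = ∑ x, spectralMatrix (U x) (a x))
    (hB : spectralMatrix V₀ b₀ = ∑ x, spectralMatrix (V x) (b x)) :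
    ∑ j, ∑ i, overlap U₀ V₀ j i * a₀ i * (Real.log (a₀ i) - Real.log (b₀ j)) ≤
      ∑ x, ∑ j, ∑ i, overlap (U x) (V x) j i * a x i *
        (Real.log (a x i) - Real.log (b x j)) := by
  have htr : ∑ j, ∑ i, overlap U₀ V₀ j i * a₀ i =
      ∑ x, ∑ j, ∑ i, overlap (U x) (V x) j i * a x i := by
    have h := congrArg trace hA
    rw [trace_sum, trace_spectralMatrix _ hV₀,
      Finset.sum_congr rfl fun x _ => trace_spectralMatrix (U x) (hV x) (a x)] at h
    exact_mod_cast h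
  let Φ : ℝ → ℝ := fun t =>
    ∑ x, logInterp (U x) (V x) (a x) (b x) t - logInterp U₀ V₀ a₀ b₀ t
  have hderiv : ∀ t, 0 ≤ t → HasDerivAt Φ
      (∑ x, ∑ j, ∑ i, overlap (U x) (V x) j i * a x i * (a x i / (b x j + t * a x i))
        - ∑ j, ∑ i, overlap U₀ V₀ j i * a₀ i * (a₀ i / (b₀ j + t * a₀ i))) t := fun t ht =>
    (HasDerivAt.fun_sum fun x _ => hasDerivAt_logInterp (ha x) (hs x) ht).sub
      (hasDerivAt_logInterp ha₀ hs₀ ht)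
  have hmono : MonotoneOn Φ (Set.Ici 0) := by
    refine monotoneOn_of_deriv_nonneg (convex_Ici 0)
      (fun t ht => (hderiv t ht).continuousAt.continuousWithinAt)
      (fun t ht => (hderiv t (interior_subset ht)).differentiableAt.differentiableWithinAt)
      fun t ht => ?_
    rw [interior_Ici, Set.mem_Ioi] at ht
    rw [(hderiv t ht.le).deriv, sub_nonneg]
    obtain ⟨X, hX⟩ := exists_resolventFunctional_eq hU₀ hV₀ a₀ b₀ t
    rw [← hX, hA, hB, resolventFunctional_sum]
    exact Finset.sum_le_sum fun x _ =>
      resolventFunctional_le (hU x) (hV x) (ha x) (hb x) X ht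
  have hlim : Tendsto Φ atTop
      (𝓝 (∑ x, ∑ j, ∑ i, overlap (U x) (V x) j i * a x i * Real.log (a x i)
        - ∑ j, ∑ i, overlap U₀ V₀ j i * a₀ i * Real.log (a₀ i))) := by
    refine ((tendsto_finsetSum Finset.univ fun x _ => tendsto_logInterp (ha x) (hs x)).sub
      (tendsto_logInterp ha₀ hs₀)).congr fun t => ?_
    rw [Finset.sum_sub_distrib, ← Finset.sum_mul, htr]
    simp only [Φ]
    ring
  have h0 : Φ 0 ≤ _ := ge_of_tendsto hlim <| by
    filter_upwards [eventually_ge_atTop (0 : ℝ)] with t ht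
    exact hmono Set.self_mem_Ici ht ht
  simp only [Φ, logInterp, zero_mul, add_zero] at h0
  simp only [mul_sub, Finset.sum_sub_distrib]
  linarith

end SpectralSums

section Spectral

variable {d : Type*} [Fintype d] [DecidableEq d]

lemma Matrix.IsHermitian.eigenvectorUnitary_mul_conjTranspose {A : Matrix d d ℂ}
    (hA : A.IsHermitian) :
    (hA.eigenvectorUnitary : Matrix d d ℂ) * (hA.eigenvectorUnitary : Matrix d d ℂ)ᴴ = 1 :=
  Unitary.mul_star_self_of_mem hA.eigenvectorUnitary.2

lemma Matrix.IsHermitian.spectralMatrix_eigenvalues {A : Matrix d d ℂ} (hA : A.IsHermitian) :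
    spectralMatrix (hA.eigenvectorUnitary : Matrix d d ℂ) hA.eigenvalues = A := by
  conv_rhs => rw [hA.spectral_theorem]
  rfl

lemma spectralMatrix_smul (U : Matrix d d ℂ) (a : d → ℝ) (c : ℝ) :
    spectralMatrix U (fun i => c * a i) = (c : ℂ) • spectralMatrix U a := by
  have : diagonal (fun i => ((c * a i : ℝ) : ℂ)) = (c : ℂ) • diagonal (fun i => (a i : ℂ)) := by
    rw [← diagonal_smul]
    congr 1
    ext i
    simp
  rw [spectralMatrix, this, spectralMatrix, Matrix.mul_smul, Matrix.smul_mul]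

lemma SupportLE.pos_of_overlap_ne_zero {U V : Matrix d d ℂ} {a b : d → ℝ} (hU : U * Uᴴ = 1)
    (hV : V * Vᴴ = 1) (hb : ∀ i, 0 ≤ b i)
    (h : SupportLE (spectralMatrix U a) (spectralMatrix V b)) (j i : d)
    (hji : overlap U V j i * a i ≠ 0) : 0 < b j := by
  refine (hb j).lt_of_ne' fun hbj => hji ?_
  have hU' : Uᴴ * U = 1 := mul_eq_one_comm.mp hU
  have hV' : Vᴴ * V = 1 := mul_eq_one_comm.mp hV
  have hker : spectralMatrix V b *ᵥ (V *ᵥ Pi.single j 1) = 0 := by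
    rw [mulVec_mulVec, spectralMatrix, Matrix.mul_assoc, hV', Matrix.mul_one, ← mulVec_mulVec,
      diagonal_mulVec_single]
    simp [hbj]
  have hker' := congrArg (Uᴴ *ᵥ ·) (h _ hker)
  simp only [mulVec_zero] at hker'
  rw [mulVec_mulVec, mulVec_mulVec, spectralMatrix, ← Matrix.mul_assoc, ← Matrix.mul_assoc, hU',
    Matrix.one_mul, Matrix.mul_assoc, ← mulVec_mulVec] at hker'
  have hi := congrFun hker' i
  rw [mulVec_diagonal, mulVec_single_one] at hi
  have hw : Uᴴ * V = (Vᴴ * U)ᴴ := by simp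
  rw [hw] at hi
  simp only [col_apply, conjTranspose_apply, Pi.zero_apply, mul_eq_zero, star_eq_zero,
    Complex.ofReal_eq_zero] at hi
  rcases hi with hi | hi
  · simp [hi]
  · simp [overlap, hi]

lemma Matrix.IsHermitian.matLog2_eq_spectralMatrix {A : Matrix d d ℂ} (hA : A.IsHermitian) :
    matLog2 A = spectralMatrix (hA.eigenvectorUnitary : Matrix d d ℂ)
      (fun i => Real.logb 2 (hA.eigenvalues i)) := by
  rw [matLog2, hermCFC, dif_pos hA]
  rfl

lemma spectralMatrix_mul {U : Matrix d d ℂ} (hU : U * Uᴴ = 1) (a b : d → ℝ) :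
    spectralMatrix U a * spectralMatrix U b = spectralMatrix U (fun i => a i * b i) := by
  have hU' : Uᴴ * U = 1 := mul_eq_one_comm.mp hU
  simp only [spectralMatrix, Matrix.mul_assoc]
  rw [← Matrix.mul_assoc Uᴴ, hU', Matrix.one_mul, ← Matrix.mul_assoc (diagonal _) (diagonal _),
    diagonal_mul_diagonal]
  simp only [Complex.ofReal_mul]

lemma relentR_eq_sum_overlap {A B : Matrix d d ℂ} (hA : A.IsHermitian) (hB : B.IsHermitian) :
    relentR A B = ∑ j, ∑ i,
      overlap (hA.eigenvectorUnitary : Matrix d d ℂ) (hB.eigenvectorUnitary : Matrix d d ℂ) j i *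
        hA.eigenvalues i *
        (Real.logb 2 (hA.eigenvalues i) - Real.logb 2 (hB.eigenvalues j)) := by
  have hUA := hA.eigenvectorUnitary_mul_conjTranspose
  have hUB := hB.eigenvectorUnitary_mul_conjTranspose
  rw [relentR, hA.matLog2_eq_spectralMatrix, hB.matLog2_eq_spectralMatrix]
  have hmul : ∀ M, A * M =
      spectralMatrix (hA.eigenvectorUnitary : Matrix d d ℂ) hA.eigenvalues * M := fun M =>
    congrArg (· * M) hA.spectralMatrix_eigenvalues.symm
  rw [hmul, hmul, spectralMatrix_mul hUA, trace_spectralMatrix _ hUB, trace_spectralMatrix_mul_spectralMatrix,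
    ← Complex.ofReal_sub, Complex.ofReal_re]
  simp only [← Finset.sum_sub_distrib]
  exact Finset.sum_congr rfl fun j _ => Finset.sum_congr rfl fun i _ => by ring

omit [DecidableEq d] in
lemma SupportLE.sum_smul {ι : Type*} [Fintype ι] {p q : ι → ℝ} (hp : ∀ x, 0 ≤ p x)
    (hq : ∀ x, 0 ≤ q x) (hqp : ∀ x, q x = 0 → p x = 0) {ρ σ : ι → Matrix d d ℂ}
    (hσ : ∀ x, (σ x).PosSemidef) (h : ∀ x, 0 < p x → SupportLE (ρ x) (σ x)) :
    SupportLE (∑ x, (p x : ℂ) • ρ x) (∑ x, (q x : ℂ) • σ x) := by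
  intro v hv
  have hsum : ∑ x, q x * (star v ⬝ᵥ σ x *ᵥ v) = 0 := by
    have := congrArg (star v ⬝ᵥ ·) hv
    simpa [sum_mulVec, dotProduct_sum, smul_mulVec] using this
  have hnonneg : ∀ x ∈ Finset.univ, (0 : ℂ) ≤ q x * (star v ⬝ᵥ σ x *ᵥ v) := fun x _ =>
    mul_nonneg (by exact_mod_cast hq x) ((hσ x).dotProduct_mulVec_nonneg v)
  rw [Finset.sum_eq_zero_iff_of_nonneg hnonneg] at hsum
  rw [sum_mulVec]
  refine Finset.sum_eq_zero fun x hx => ?_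
  rw [smul_mulVec]
  rcases (hp x).eq_or_lt with hpx | hpx
  · simp [← hpx]
  · have hqx : (q x : ℂ) ≠ 0 := by exact_mod_cast fun h0 => hpx.ne' (hqp x h0)
    have hσv := ((hσ x).dotProduct_mulVec_zero_iff v).mp
      ((mul_eq_zero.mp (hsum x hx)).resolve_left hqx)
    rw [h x hpx v hσv, smul_zero]

lemma mul_logb_mul_sub_logb_mul {w a b p q : ℝ} (hp : 0 ≤ p)
    (hqp : q = 0 → p = 0) (hb : 0 < p → w * a ≠ 0 → 0 < b) :
    w * (p * a) * (Real.logb 2 (p * a) - Real.logb 2 (q * b)) =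
      p * Real.logb 2 (p / q) * (w * a) +
        p * (w * a * (Real.logb 2 a - Real.logb 2 b)) := by
  rcases hp.eq_or_lt with rfl | hp
  · simp
  by_cases hwa : w * a = 0
  · rw [mul_left_comm, hwa]
    simp
  have hq0 : q ≠ 0 := fun h => hp.ne' (hqp h)
  rw [Real.logb_mul hp.ne' (right_ne_zero_of_mul hwa), Real.logb_mul hq0 (hb hp hwa).ne',
    Real.logb_div hp.ne' hq0]
  ring

lemma sum_mul_relent_eq_coe {ι : Type*} [Fintype ι] {p : ι → ℝ} (hp : ∀ x, 0 ≤ p x)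
    {ρ σ : ι → Matrix d d ℂ} (h : ∀ x, 0 < p x → SupportLE (ρ x) (σ x)) :
    ∑ x, (p x : EReal) * relent (ρ x) (σ x) = ((∑ x, p x * relentR (ρ x) (σ x) : ℝ) : EReal) := by
  have hcoe : ((∑ x, p x * relentR (ρ x) (σ x) : ℝ) : EReal) =
      ∑ x, ((p x * relentR (ρ x) (σ x) : ℝ) : EReal) :=
    map_sum (⟨⟨Real.toEReal, EReal.coe_zero⟩, EReal.coe_add⟩ : ℝ →+ EReal) _ _
  rw [hcoe]
  refine Finset.sum_congr rfl fun x _ => ?_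
  rcases (hp x).eq_or_lt with hpx | hpx
  · simp [← hpx]
  · rw [relent, if_pos (h x hpx), EReal.coe_mul]

end Spectral

/-- Convexity-type bound for relative entropy of mixtures:
D(Σ_x p(x)·ρ_x ‖ Σ_x q(x)·σ_x) ≤ Σ_x p(x)·log(p(x)/q(x)) + Σ_x p(x)·D(ρ_x ‖ σ_x). -/
theorem relent_mixture_le {d : Type} [Fintype d] [DecidableEq d] [Nonempty d]
    (m : ℕ) (hm : 1 ≤ m)
    (p q : Fin m → ℝ)
    (hp0 : ∀ x, 0 ≤ p x) (hq0 : ∀ x, 0 ≤ q x)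
    (hp1 : ∑ x, p x = 1) (hq1 : ∑ x, q x = 1)
    (hqp : ∀ x, q x = 0 → p x = 0)
    (ρ σ : Fin m → Matrix d d ℂ)
    (hρ : ∀ x, IsDensityMatrix (ρ x)) (hσ : ∀ x, IsDensityMatrix (σ x))
    (hsupp : ∀ x, 0 < p x → SupportLE (ρ x) (σ x)) :
    relent (∑ x, ((p x : ℂ)) • ρ x) (∑ x, ((q x : ℂ)) • σ x) ≤
      ((∑ x, p x * Real.logb 2 (p x / q x) : ℝ) : EReal)
        + ∑ x, ((p x : ℝ) : EReal) * relent (ρ x) (σ x) := by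
  have hρh : ∀ x, (ρ x).IsHermitian := fun x => (hρ x).1.isHermitian
  have hσh : ∀ x, (σ x).IsHermitian := fun x => (hσ x).1.isHermitian
  have hA : (∑ x, (p x : ℂ) • ρ x).PosSemidef := posSemidef_sum _ fun x _ =>
    (hρ x).1.smul (by exact_mod_cast hp0 x)
  have hB : (∑ x, (q x : ℂ) • σ x).PosSemidef := posSemidef_sum _ fun x _ =>
    (hσ x).1.smul (by exact_mod_cast hq0 x)
  have hAB := SupportLE.sum_smul hp0 hq0 hqp (fun x => (hσ x).1) hsupp
  rw [relent, if_pos hAB, sum_mul_relent_eq_coe hp0 hsupp, ← EReal.coe_add, EReal.coe_le_coe_iff,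
    relentR_eq_sum_overlap hA.isHermitian hB.isHermitian]
  have hpos : ∀ x, 0 < p x → ∀ j i,
      overlap ((hρh x).eigenvectorUnitary : Matrix d d ℂ)
        ((hσh x).eigenvectorUnitary : Matrix d d ℂ) j i * (hρh x).eigenvalues i ≠ 0 →
      0 < (hσh x).eigenvalues j := fun x hpx => by
    refine SupportLE.pos_of_overlap_ne_zero (hρh x).eigenvectorUnitary_mul_conjTranspose
      (hσh x).eigenvectorUnitary_mul_conjTranspose (hσ x).1.eigenvalues_nonneg ?_
    rw [(hρh x).spectralMatrix_eigenvalues, (hσh x).spectralMatrix_eigenvalues]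
    exact hsupp x hpx
  have key := sum_overlap_mul_log_sub_le
    (fun x => (hρh x).eigenvectorUnitary_mul_conjTranspose)
    (fun x => (hσh x).eigenvectorUnitary_mul_conjTranspose)
    (a := fun x i => p x * (hρh x).eigenvalues i) (b := fun x i => q x * (hσh x).eigenvalues i)
    (fun x i => mul_nonneg (hp0 x) ((hρ x).1.eigenvalues_nonneg i))
    (fun x i => mul_nonneg (hq0 x) ((hσ x).1.eigenvalues_nonneg i))
    (fun x j i hne => by
      rw [mul_left_comm] at hne
      have hpx := (hp0 x).lt_of_ne' (left_ne_zero_of_mul hne)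
      exact mul_pos ((hq0 x).lt_of_ne' fun h => hpx.ne' (hqp x h))
        (hpos x hpx j i (right_ne_zero_of_mul hne)))
    hA.isHermitian.eigenvectorUnitary_mul_conjTranspose
    hB.isHermitian.eigenvectorUnitary_mul_conjTranspose hA.eigenvalues_nonneg
    (SupportLE.pos_of_overlap_ne_zero hA.isHermitian.eigenvectorUnitary_mul_conjTranspose
      hB.isHermitian.eigenvectorUnitary_mul_conjTranspose hB.eigenvalues_nonneg
      (by rwa [hA.isHermitian.spectralMatrix_eigenvalues,
        hB.isHermitian.spectralMatrix_eigenvalues]))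
    (by simp only [spectralMatrix_smul, IsHermitian.spectralMatrix_eigenvalues])
    (by simp only [spectralMatrix_smul, IsHermitian.spectralMatrix_eigenvalues])
  have key2 := div_le_div_of_nonneg_right key (Real.log_nonneg one_le_two)
  simp only [Finset.sum_div, mul_div_assoc, sub_div, Real.log_div_log] at key2
  refine key2.trans_eq ?_
  rw [← Finset.sum_add_distrib]
  refine Finset.sum_congr rfl fun x _ => ?_
  have htr : ∑ j, ∑ i, overlap ((hρh x).eigenvectorUnitary : Matrix d d ℂ)
      ((hσh x).eigenvectorUnitary : Matrix d d ℂ) j i * (hρh x).eigenvalues i = 1 := by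
    have h := trace_spectralMatrix ((hρh x).eigenvectorUnitary : Matrix d d ℂ)
      (hσh x).eigenvectorUnitary_mul_conjTranspose (hρh x).eigenvalues
    rw [(hρh x).spectralMatrix_eigenvalues, (hρ x).2] at h
    exact_mod_cast h.symm
  rw [relentR_eq_sum_overlap (hρh x) (hσh x), ← mul_one (p x * Real.logb 2 (p x / q x)), ← htr]
  simp only [Finset.mul_sum, ← Finset.sum_add_distrib]
  exact Finset.sum_congr rfl fun j _ => Finset.sum_congr rfl fun i _ =>
    mul_logb_mul_sub_logb_mul (hp0 x) (hqp x) fun hpx => hpos x hpx j i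

end
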